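/- arXiv:2411.10008 — 5 statements merged into one kernel-verified Lean document; each statement's English description precedes it below -/
import Mathlib

section
/- Fix an enumeration i_1, …, i_n of ι. Then the sum, over all full assignments v : ∀ i, α i, of the product ∏_{k=1}^{n} P_D( v(i_k) | v restricted to {i_1, …, i_{k-1}} ) equals 1; that is, the empirical Bayesian network along a complete variable ordering defines a probability distribution over the full configuration space (namely the empirical distribution v ↦ #D(v)/|D|). -/
/-! STATEMENT 4: the empirical Bayesian network along a complete variable
ordering defines a probability distribution: the chain-rule products of
empirical conditionals sum to 1 over all full assignments. -/

open Finset

variable {ι : Type*} [Fintype ι] [DecidableEq ι]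
variable {α : ι → Type*} [∀ i, Fintype (α i)] [∀ i, DecidableEq (α i)]
  [∀ i, Nonempty (α i)]

/-- Restriction of a full assignment to the variables in `S`. -/
def restrictTo (S : Finset ι) (v : ∀ i, α i) : ∀ i : S, α i := fun i => v i

/-- The count `#D(s)`: number of records of `D` whose restriction to `S` is `s`. -/
def count (D : List (∀ i, α i)) (S : Finset ι) (s : ∀ i : S, α i) : ℕ :=
  D.countP (fun v => decide (restrictTo S v = s))

/-- The partial assignment on `{j} ∪ P` determined by `x : α j` and `pa` on `P`. -/
def pairAssign (j : ι) (P : Finset ι) (x : α j) (pa : ∀ i : P, α i) :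
    ∀ i : (insert j P : Finset ι), α i := fun i =>
  if h : (i : ι) ∈ P then pa ⟨i, h⟩
  else cast (congrArg α ((Finset.mem_insert.mp i.2).resolve_right h).symm) x

/-- Empirical conditional probability `P_D(x | pa)`. -/
noncomputable def condP (D : List (∀ i, α i)) (j : ι) (P : Finset ι)
    (x : α j) (pa : ∀ i : P, α i) : ℝ :=
  if 0 < count D P pa then
    (count D (insert j P) (pairAssign j P x pa) : ℝ) / (count D P pa : ℝ)
  else 0

theorem count_restrictTo (D : List (∀ i, α i)) (S : Finset ι) (v : ∀ i, α i) :
    count D S (restrictTo S v) = D.countP (fun w => decide (∀ i ∈ S, w i = v i)) := by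
  unfold count
  congr 1
  funext w
  simp [restrictTo, funext_iff]

theorem pairAssign_restrictTo (j : ι) (P : Finset ι) (v : ∀ i, α i) :
    pairAssign j P (v j) (restrictTo P v) = restrictTo (insert j P) v := by
  funext ⟨i, hi⟩
  by_cases h : i ∈ P
  · simp [pairAssign, restrictTo, h]
  · obtain rfl := (Finset.mem_insert.mp hi).resolve_right h
    simp [pairAssign, restrictTo, h]

theorem condP_restrictTo (D : List (∀ i, α i)) (j : ι) (P : Finset ι) (v : ∀ i, α i) :
    condP D j P (v j) (restrictTo P v) =
      (count D (insert j P) (restrictTo (insert j P) v) : ℝ) / count D P (restrictTo P v) := by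
  rw [condP, pairAssign_restrictTo]
  split_ifs with h
  · rfl
  · simp [Nat.eq_zero_of_not_pos h]

theorem count_restrictTo_anti (D : List (∀ i, α i)) {S T : Finset ι} (h : S ⊆ T)
    (v : ∀ i, α i) : count D T (restrictTo T v) ≤ count D S (restrictTo S v) := by
  simp only [count_restrictTo]
  refine List.countP_mono_left fun w _ hw => ?_
  simp only [decide_eq_true_eq] at hw ⊢
  exact fun i hi => hw i (h hi)

theorem prod_range_div_of_zero_imp {K : Type*} [Field K] (g : ℕ → K) (h0 : g 0 ≠ 0)
    (hg : ∀ k, g k = 0 → g (k + 1) = 0) (n : ℕ) :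
    ∏ k ∈ Finset.range n, g (k + 1) / g k = g n / g 0 := by
  induction n with
  | zero => simp [h0]
  | succ n ih =>
    rw [Finset.prod_range_succ, ih]
    by_cases h : g n = 0
    · simp [h, hg n h]
    · field_simp

/-- The chain-rule product of empirical conditionals is the empirical distribution. -/
theorem prod_condP_eq (D : List (∀ i, α i)) (hD : D ≠ []) (n : ℕ) (e : Fin n ≃ ι)
    (v : ∀ i, α i) :
    ∏ k : Fin n, condP D (e k) ((Finset.Iio k).image e) (v (e k))
        (restrictTo ((Finset.Iio k).image e) v) =
      (count D Finset.univ (restrictTo Finset.univ v) : ℝ) / D.length := by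
  let S : ℕ → Finset ι := fun m => {i | (e.symm i : ℕ) < m}
  let g : ℕ → ℝ := fun m => count D (S m) (restrictTo (S m) v)
  have hS (k : Fin n) : (Finset.Iio k).image e = S k := by
    ext i
    simp only [S, Finset.mem_image, Finset.mem_Iio, Finset.mem_filter, Finset.mem_univ, true_and]
    exact ⟨by rintro ⟨a, ha, rfl⟩; simpa using ha, fun h => ⟨e.symm i, h, by simp⟩⟩
  have hins (k : Fin n) : insert (e k) (S k) = S (k + 1) := by
    ext i
    simp only [S, Finset.mem_insert, Finset.mem_filter, Finset.mem_univ, true_and,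
      ← Equiv.symm_apply_eq, Fin.ext_iff]
    omega
  have h0 : g 0 = D.length := by simp [g, S, count_restrictTo]
  have hn : S n = Finset.univ := by ext i; simp [S]
  have hg (k : ℕ) (hk : g k = 0) : g (k + 1) = 0 := by
    have hsub : S k ⊆ S (k + 1) := fun i hi => by
      simp only [S, Finset.mem_filter, Finset.mem_univ, true_and] at hi ⊢
      omega
    have hle := count_restrictTo_anti D hsub v
    simp only [g, Nat.cast_eq_zero] at hk ⊢
    omega
  have hfac (k : Fin n) : condP D (e k) ((Finset.Iio k).image e) (v (e k))
      (restrictTo ((Finset.Iio k).image e) v) = g (k + 1) / g k := by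
    rw [hS, condP_restrictTo, hins]
  rw [Finset.prod_congr rfl fun k _ => hfac k,
    Fin.prod_univ_eq_prod_range (fun k => g (k + 1) / g k) n,
    prod_range_div_of_zero_imp g (by simpa [h0] using hD) hg, h0]
  change (count D (S n) (restrictTo (S n) v) : ℝ) / _ = _
  rw [hn]

theorem sum_count_univ (D : List (∀ i, α i)) :
    ∑ v : ∀ i, α i, count D Finset.univ (restrictTo Finset.univ v) = D.length := by
  simp only [count_restrictTo, Finset.mem_univ, forall_const, ← funext_iff]
  induction D with
  | nil => simp
  | cons w D ih => simp [List.countP_cons, Finset.sum_add_distrib, ih]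

theorem sum_chain_rule_empirical_eq_one (D : List (∀ i, α i)) (hD : D ≠ [])
    (n : ℕ) (e : Fin n ≃ ι) :
    ∑ v : ∀ i, α i, ∏ k : Fin n,
        condP D (e k) ((Finset.Iio k).image e) (v (e k))
          (restrictTo ((Finset.Iio k).image e) v) = 1 := by
  simp only [prod_condP_eq D hD n e]
  rw [← Finset.sum_div, ← Nat.cast_sum, sum_count_univ]
  exact div_self (by simpa using hD)
end

section
/- Let f : (∀ i, α i) → ℝ≥0 have scope S and let Z ⊆ S. Define the marginal g by g(v) = ∑ over assignments z to Z of f(v updated on Z by z). Then g has scope S \ Z, and the support of g relative to S \ Z is exactly the image of the support of f relative to S under restriction to S \ Z. In particular, the tightness of g relative to S \ Z is at most the tightness of f relative to S. -/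
/-! STATEMENT 6: marginalizing f (of scope S) over Z ⊆ S yields a function of
scope S \ Z whose support is exactly the image of the support of f under
restriction to S \ Z; in particular its tightness is at most that of f. -/

open Finset
open scoped NNReal

variable {ι : Type*} [Fintype ι] [DecidableEq ι]
variable {α : ι → Type*} [∀ i, Fintype (α i)] [∀ i, DecidableEq (α i)]

/-- `f` has scope `S` if its value depends only on the variables in `S`. -/
def HasScope (f : (∀ i, α i) → ℝ≥0) (S : Finset ι) : Prop :=
  ∀ v w : ∀ i, α i, (∀ i ∈ S, v i = w i) → f v = f w

/-- The support of `f` relative to a scope `S`: partial assignments on `S` at some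
(equivalently, when `f` has scope `S`, every) full extension of which `f` is nonzero. -/
def supportOn (f : (∀ i, α i) → ℝ≥0) (S : Finset ι) : Set (∀ i : S, α i) :=
  {s | ∃ v : ∀ i, α i, restrictTo S v = s ∧ f v ≠ 0}

/-- The tightness of `f` relative to `S`: the number of nonzero configurations. -/
noncomputable def tightness (f : (∀ i, α i) → ℝ≥0) (S : Finset ι) : ℕ :=
  (supportOn f S).ncard

/-- `v` updated on the variables of `Z` by the partial assignment `z`. -/
def updateOn (v : ∀ i, α i) (Z : Finset ι) (z : ∀ i : Z, α i) : ∀ i, α i :=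
  fun i => if h : i ∈ Z then z ⟨i, h⟩ else v i

/-- Restriction of a partial assignment on `S` to the variables of `S \ Z`. -/
def restrictSdiff (S Z : Finset ι) (s : ∀ i : S, α i) : ∀ i : (S \ Z : Finset ι), α i :=
  fun i => s ⟨i, (Finset.mem_sdiff.mp i.2).1⟩

theorem updateOn_restrictTo (v : ∀ i, α i) (Z : Finset ι) :
    updateOn v Z (restrictTo Z v) = v := by
  funext i
  simp [updateOn, restrictTo]

theorem restrictSdiff_restrictTo_updateOn (v : ∀ i, α i) (S Z : Finset ι) (z : ∀ i : Z, α i) :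
    restrictSdiff S Z (restrictTo S (updateOn v Z z)) = restrictTo (S \ Z) v := by
  funext i
  simp [restrictSdiff, restrictTo, updateOn, (Finset.mem_sdiff.mp i.2).2]

theorem HasScope.marginal {f : (∀ i, α i) → ℝ≥0} {S : Finset ι} (hf : HasScope f S)
    (Z : Finset ι) :
    HasScope (fun v => ∑ z : ∀ i : Z, α i, f (updateOn v Z z)) (S \ Z) := by
  intro v w hvw
  refine Finset.sum_congr rfl fun z _ => hf _ _ fun i hi => ?_
  by_cases h : i ∈ Z
  · simp [updateOn, h]
  · simpa [updateOn, h] using hvw i (Finset.mem_sdiff.mpr ⟨hi, h⟩)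

theorem supportOn_marginal (f : (∀ i, α i) → ℝ≥0) (S Z : Finset ι) :
    supportOn (fun v => ∑ z : ∀ i : Z, α i, f (updateOn v Z z)) (S \ Z)
      = restrictSdiff S Z '' supportOn f S := by
  ext s
  constructor
  · rintro ⟨v, rfl, hv⟩
    obtain ⟨z, -, hz⟩ := Finset.exists_ne_zero_of_sum_ne_zero hv
    exact ⟨_, ⟨updateOn v Z z, rfl, hz⟩, restrictSdiff_restrictTo_updateOn v S Z z⟩
  · rintro ⟨_, ⟨v, rfl, hv⟩, rfl⟩
    refine ⟨v, rfl, fun h => hv ?_⟩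
    simpa [updateOn_restrictTo] using
      Finset.sum_eq_zero_iff.mp h (restrictTo Z v) (Finset.mem_univ _)

theorem marginal_scope_support_tightness (f : (∀ i, α i) → ℝ≥0) (S Z : Finset ι)
    (hf : HasScope f S) (hZ : Z ⊆ S) :
    HasScope (fun v => ∑ z : ∀ i : Z, α i, f (updateOn v Z z)) (S \ Z) ∧
    supportOn (fun v => ∑ z : ∀ i : Z, α i, f (updateOn v Z z)) (S \ Z)
      = restrictSdiff S Z '' supportOn f S ∧
    tightness (fun v => ∑ z : ∀ i : Z, α i, f (updateOn v Z z)) (S \ Z)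
      ≤ tightness f S := by
  refine ⟨hf.marginal Z, supportOn_marginal f S Z, ?_⟩
  rw [tightness, supportOn_marginal]
  exact Set.ncard_image_le (Set.toFinite _)
end

section
/- Let f_1, …, f_m : (∀ i, α i) → ℝ≥0, where each f_k has scope S_k and tightness at most t_k relative to S_k, and let Z ⊆ ⋃_k S_k. Then the sum-product message v ↦ ∑ over assignments z to Z of ∏_{k=1}^m f_k(v updated on Z by z) has scope (⋃_k S_k) \ Z, and its tightness relative to this scope is at most ∏_{k=1}^m t_k. (This bounds the size of every message table generated by cluster-tree elimination on a hypertree-decomposition cluster containing m functions.) -/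
/-! STATEMENT 7: a sum-product message over a cluster of m functions with
scopes S_k and tightness at most t_k, marginalizing Z ⊆ ⋃ S_k, has scope
(⋃ S_k) \ Z and tightness at most ∏ t_k. -/

open Finset
open scoped NNReal

variable {ι : Type*} [Fintype ι] [DecidableEq ι]
variable {α : ι → Type*} [∀ i, Fintype (α i)] [∀ i, DecidableEq (α i)]

theorem HasScope.sum_prod_updateOn {κ : Type*} [Fintype κ] {f : κ → (∀ i, α i) → ℝ≥0}
    {S : κ → Finset ι} (hf : ∀ k, HasScope (f k) (S k)) (Z : Finset ι) :
    HasScope (fun v => ∑ z : ∀ i : Z, α i, ∏ k, f k (updateOn v Z z))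
      (Finset.univ.biUnion S \ Z) := by
  intro v w h
  refine Finset.sum_congr rfl fun z _ => Finset.prod_congr rfl fun k _ => hf k _ _ fun i hi => ?_
  by_cases hiZ : i ∈ Z
  · simp [updateOn, hiZ]
  · simpa [updateOn, hiZ] using
      h i (Finset.mem_sdiff.2 ⟨Finset.mem_biUnion.2 ⟨k, Finset.mem_univ k, hi⟩, hiZ⟩)

/-- A configuration in the support of a sum-product message extends to a full assignment
at which every factor is nonzero. -/
theorem exists_extension_of_mem_supportOn_message {κ : Type*} [Fintype κ]
    {f : κ → (∀ i, α i) → ℝ≥0} {U Z : Finset ι} {s : ∀ i : (U \ Z : Finset ι), α i}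
    (hs : s ∈ supportOn (fun v => ∑ z : ∀ i : Z, α i, ∏ k, f k (updateOn v Z z)) (U \ Z)) :
    ∃ w : ∀ i, α i, restrictTo (U \ Z) w = s ∧ ∀ k, f k w ≠ 0 := by
  obtain ⟨v, rfl, hv⟩ := hs
  obtain ⟨z, -, hz⟩ := Finset.exists_ne_zero_of_sum_ne_zero hv
  refine ⟨updateOn v Z z, ?_, fun k => Finset.prod_ne_zero_iff.1 hz k (Finset.mem_univ k)⟩
  funext i
  simp [restrictTo, updateOn, (Finset.mem_sdiff.1 i.2).2]

theorem tightness_message_le_prod {κ : Type*} [Fintype κ] (f : κ → (∀ i, α i) → ℝ≥0)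
    (S : κ → Finset ι) (Z : Finset ι) :
    tightness (fun v => ∑ z : ∀ i : Z, α i, ∏ k, f k (updateOn v Z z))
      (Finset.univ.biUnion S \ Z) ≤ ∏ k, tightness (f k) (S k) := by
  choose w hws hwf using fun s : supportOn (fun v => ∑ z : ∀ i : Z, α i,
    ∏ k, f k (updateOn v Z z)) (Finset.univ.biUnion S \ Z) =>
      exists_extension_of_mem_supportOn_message s.2
  have hinj : Function.Injective fun s k =>
      (⟨restrictTo (S k) (w s), w s, rfl, hwf s k⟩ : supportOn (f k) (S k)) := by
    intro s s' h
    apply Subtype.ext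
    rw [← hws s, ← hws s']
    funext i
    obtain ⟨k, -, hk⟩ := Finset.mem_biUnion.1 (Finset.mem_sdiff.1 i.2).1
    exact congrFun (congrArg Subtype.val (congrFun h k)) ⟨i, hk⟩
  simpa only [tightness, Nat.card_pi, Nat.card_coe_set_eq] using
    Nat.card_le_card_of_injective _ hinj

theorem tightness_sum_product_message (m : ℕ) (f : Fin m → (∀ i, α i) → ℝ≥0)
    (S : Fin m → Finset ι) (t : Fin m → ℕ)
    (hf : ∀ k, HasScope (f k) (S k)) (ht : ∀ k, tightness (f k) (S k) ≤ t k)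
    (Z : Finset ι) (hZ : Z ⊆ Finset.univ.biUnion S) :
    HasScope (fun v => ∑ z : ∀ i : Z, α i, ∏ k, f k (updateOn v Z z))
        (Finset.univ.biUnion S \ Z) ∧
    tightness (fun v => ∑ z : ∀ i : Z, α i, ∏ k, f k (updateOn v Z z))
        (Finset.univ.biUnion S \ Z) ≤ ∏ k, t k :=
  ⟨HasScope.sum_prod_updateOn hf Z,
    (tightness_message_le_prod f S Z).trans (Finset.prod_le_prod' fun k _ => ht k)⟩
end

section
/- Let g : (∀ i, α i) → ℝ≥0 have scope T and tightness at most s relative to T, let f_1, …, f_m : (∀ i, α i) → ℝ≥0 have scopes S_1, …, S_m with tightness at most t each, and let Z ⊆ T ∪ ⋃_k S_k. Then the function v ↦ ∑ over assignments z to Z of ( g · ∏_{k=1}^m f_k )(v updated on Z by z) has scope (T ∪ ⋃_k S_k) \ Z, and its tightness relative to this scope is at most s · t^m. (This is the inductive step bounding the tightness of the output function of one level of a sum-product hierarchy given the output function of the previous level.) -/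
/-! STATEMENT 8: inductive step for a sum-product hierarchy: marginalizing
Z ⊆ T ∪ ⋃ S_k from the product of g (scope T, tightness ≤ s) with m functions
of tightness ≤ t yields a function of scope (T ∪ ⋃ S_k) \ Z and tightness at
most s * t^m. -/

open Finset
open scoped NNReal

variable {ι : Type*} [Fintype ι] [DecidableEq ι]
variable {α : ι → Type*} [∀ i, Fintype (α i)] [∀ i, DecidableEq (α i)]

theorem HasScope.mul_prod {κ : Type*} [Fintype κ] {g : (∀ i, α i) → ℝ≥0} {T : Finset ι}
    {f : κ → (∀ i, α i) → ℝ≥0} {S : κ → Finset ι}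
    (hg : HasScope g T) (hf : ∀ k, HasScope (f k) (S k)) :
    HasScope (fun v => g v * ∏ k, f k v) (T ∪ Finset.univ.biUnion S) := by
  intro v w h
  have hgvw : g v = g w := hg v w fun i hi => h i (mem_union_left _ hi)
  have hfvw : ∀ k, f k v = f k w := fun k => hf k v w fun i hi =>
    h i (mem_union_right _ (mem_biUnion.2 ⟨k, mem_univ k, hi⟩))
  simp only [hgvw, hfvw]

/-- A nonzero configuration of a product is determined by its restrictions to the scopes of
the factors, each of which is a nonzero configuration of that factor. -/
theorem tightness_mul_prod_le {κ : Type*} [Fintype κ] (g : (∀ i, α i) → ℝ≥0) (T : Finset ι)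
    (f : κ → (∀ i, α i) → ℝ≥0) (S : κ → Finset ι) :
    tightness (fun v => g v * ∏ k, f k v) (T ∪ Finset.univ.biUnion S) ≤
      tightness g T * ∏ k, tightness (f k) (S k) := by
  have key : ∀ x : supportOn (fun v => g v * ∏ k, f k v) (T ∪ Finset.univ.biUnion S),
      ∃ u, restrictTo (T ∪ Finset.univ.biUnion S) u = x.1 ∧ g u ≠ 0 ∧ ∀ k, f k u ≠ 0 := by
    rintro ⟨x, u, hux, hu⟩
    exact ⟨u, hux, left_ne_zero_of_mul hu,
      fun k => prod_ne_zero_iff.1 (right_ne_zero_of_mul hu) k (mem_univ k)⟩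
  choose u hux hgu hfu using key
  let φ : supportOn (fun v => g v * ∏ k, f k v) (T ∪ Finset.univ.biUnion S) →
      supportOn g T × ∀ k, supportOn (f k) (S k) := fun x =>
    (⟨restrictTo T (u x), u x, rfl, hgu x⟩,
      fun k => ⟨restrictTo (S k) (u x), u x, rfl, hfu x k⟩)
  have hφ : Function.Injective φ := by
    intro x y hxy
    have hT : restrictTo T (u x) = restrictTo T (u y) :=
      congrArg (fun p => p.1.1) hxy
    have hS : ∀ k, restrictTo (S k) (u x) = restrictTo (S k) (u y) := fun k =>
      congrArg (fun p => (p.2 k).1) hxy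
    apply Subtype.ext
    rw [← hux x, ← hux y]
    funext ⟨i, hi⟩
    rcases mem_union.1 hi with hi | hi
    · exact congrFun hT ⟨i, hi⟩
    · obtain ⟨k, -, hk⟩ := mem_biUnion.1 hi
      exact congrFun (hS k) ⟨i, hk⟩
  simpa only [tightness, Nat.card_prod, Nat.card_pi, Nat.card_coe_set_eq] using
    Nat.card_le_card_of_injective φ hφ

theorem HasScope.sum_updateOn {h : (∀ i, α i) → ℝ≥0} {U : Finset ι} (hh : HasScope h U)
    (Z : Finset ι) :
    HasScope (fun v => ∑ z : ∀ i : Z, α i, h (updateOn v Z z)) (U \ Z) := by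
  intro v w hvw
  refine sum_congr rfl fun z _ => hh _ _ fun i hi => ?_
  unfold updateOn
  split_ifs with hiZ
  · rfl
  · exact hvw i (mem_sdiff.2 ⟨hi, hiZ⟩)

theorem tightness_sum_updateOn_le (h : (∀ i, α i) → ℝ≥0) (U Z : Finset ι) :
    tightness (fun v => ∑ z : ∀ i : Z, α i, h (updateOn v Z z)) (U \ Z) ≤ tightness h U := by
  have hsub : supportOn (fun v => ∑ z : ∀ i : Z, α i, h (updateOn v Z z)) (U \ Z) ⊆
      Finset.restrict₂ (π := α) sdiff_subset '' supportOn h U := by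
    rintro _ ⟨v, rfl, hv⟩
    obtain ⟨z, -, hz⟩ := exists_ne_zero_of_sum_ne_zero hv
    refine ⟨_, ⟨updateOn v Z z, rfl, hz⟩, ?_⟩
    funext ⟨i, hi⟩
    exact dif_neg (mem_sdiff.1 hi).2
  exact (Set.ncard_le_ncard hsub).trans (Set.ncard_image_le (Set.toFinite _))

theorem tightness_level_step (g : (∀ i, α i) → ℝ≥0) (T : Finset ι) (s : ℕ)
    (hg : HasScope g T) (hgt : tightness g T ≤ s)
    (m : ℕ) (f : Fin m → (∀ i, α i) → ℝ≥0) (S : Fin m → Finset ι) (t : ℕ)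
    (hf : ∀ k, HasScope (f k) (S k)) (ht : ∀ k, tightness (f k) (S k) ≤ t)
    (Z : Finset ι) (hZ : Z ⊆ T ∪ Finset.univ.biUnion S) :
    HasScope
        (fun v => ∑ z : ∀ i : Z, α i,
          g (updateOn v Z z) * ∏ k, f k (updateOn v Z z))
        ((T ∪ Finset.univ.biUnion S) \ Z) ∧
    tightness
        (fun v => ∑ z : ∀ i : Z, α i,
          g (updateOn v Z z) * ∏ k, f k (updateOn v Z z))
        ((T ∪ Finset.univ.biUnion S) \ Z) ≤ s * t ^ m := by
  refine ⟨(hg.mul_prod hf).sum_updateOn Z, ?_⟩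
  calc
    _ ≤ tightness (fun v => g v * ∏ k, f k v) (T ∪ Finset.univ.biUnion S) :=
      tightness_sum_updateOn_le (fun v => g v * ∏ k, f k v) _ Z
    _ ≤ tightness g T * ∏ k, tightness (f k) (S k) := tightness_mul_prod_le g T f S
    _ ≤ s * t ^ m := by
      gcongr
      simpa using prod_le_pow_card univ (fun k => tightness (f k) (S k)) t fun k _ => ht k
end

section
/- Let t ∈ ℕ and let g_0, g_1, …, g_l : (∀ i, α i) → ℝ≥0 with scopes T_0, …, T_l be such that g_0 has tightness at most 1 relative to T_0, and for each level i ∈ {1, …, l} there are functions f_{i,1}, …, f_{i,hw_i}, each with some scope and tightness at most t, and a set Z_i ⊆ T_{i-1} ∪ ⋃_j scope(f_{i,j}), with T_i = (T_{i-1} ∪ ⋃_j scope(f_{i,j})) \ Z_i and g_i(v) = ∑ over assignments z to Z_i of ( g_{i-1} · ∏_{j=1}^{hw_i} f_{i,j} )(v updated on Z_i by z). Then g_l has tightness at most t^{hw_1 + hw_2 + ⋯ + hw_l} relative to T_l. (This is the tightness bound underlying the complexity O(n · t^{∑_{i=1}^l hw_i}) of plug-in hypertree evaluation over a sum-product hierarchy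 of depth l with level hypertree widths hw_i.) -/
/-! STATEMENT 9: tightness bound for a sum-product hierarchy of depth l with
level hypertree widths hw_i: the output function g_l of the top level has
tightness at most t^(hw_1 + ... + hw_l) relative to its scope T_l. -/

open Finset
open scoped NNReal

variable {ι : Type*} [Fintype ι] [DecidableEq ι]
variable {α : ι → Type*} [∀ i, Fintype (α i)] [∀ i, DecidableEq (α i)]

/-- If every nonzero point of `g'` agrees on `T'` with a common nonzero point of `g` and of all
the `f j`, whose scopes together cover `T'`, then the tightness of `g'` is at most the product of
the tightnesses of `g` and of the `f j`. -/
theorem tightness_le_mul_prod {κ : Type*} [Fintype κ] {g g' : (∀ i, α i) → ℝ≥0}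
    {T T' : Finset ι} {f : κ → (∀ i, α i) → ℝ≥0} {S : κ → Finset ι}
    (hT : T' ⊆ T ∪ Finset.univ.biUnion S)
    (h : ∀ v, g' v ≠ 0 → ∃ w, (∀ i ∈ T', w i = v i) ∧ g w ≠ 0 ∧ ∀ j, f j w ≠ 0) :
    tightness g' T' ≤ tightness g T * ∏ j, tightness (f j) (S j) := by
  have key : ∀ s : supportOn g' T', ∃ w, restrictTo T' w = s ∧ g w ≠ 0 ∧ ∀ j, f j w ≠ 0 := by
    rintro ⟨s, v, rfl, hv⟩
    obtain ⟨w, hw, hgw, hfw⟩ := h v hv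
    exact ⟨w, funext fun i => hw i i.2, hgw, hfw⟩
  choose w hw hgw hfw using key
  let Φ : supportOn g' T' → supportOn g T × ∀ j, supportOn (f j) (S j) := fun s =>
    (⟨restrictTo T (w s), w s, rfl, hgw s⟩, fun j => ⟨restrictTo (S j) (w s), w s, rfl, hfw s j⟩)
  have hΦ : Function.Injective Φ := by
    intro s s' hs
    have hg : restrictTo T (w s) = restrictTo T (w s') := congrArg (fun p => p.1.1) hs
    have hf : ∀ j, restrictTo (S j) (w s) = restrictTo (S j) (w s') :=
      fun j => congrArg (fun p => (p.2 j).1) hs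
    apply Subtype.ext
    rw [← hw s, ← hw s']
    funext ⟨i, hi⟩
    rcases Finset.mem_union.1 (hT hi) with hi | hi
    · exact congrFun hg ⟨i, hi⟩
    · obtain ⟨j, -, hj⟩ := Finset.mem_biUnion.1 hi
      exact congrFun (hf j) ⟨i, hj⟩
  simpa [tightness, Nat.card_prod, Nat.card_pi, Nat.card_coe_set_eq] using
    Nat.card_le_card_of_injective Φ hΦ

/-- A sequence starting at most at `1` and growing at step `i` at most by the factor `t ^ e i` ends
at most at `t` to the sum of the exponents. -/
theorem last_le_pow_sum {l : ℕ} {t : ℕ} {a : Fin (l + 1) → ℕ} {e : Fin l → ℕ} (h₀ : a 0 ≤ 1)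
    (h : ∀ i : Fin l, a i.succ ≤ a i.castSucc * t ^ e i) :
    a (Fin.last l) ≤ t ^ ∑ i, e i := by
  induction l with
  | zero => simpa using h₀
  | succ l ih =>
    rw [Fin.sum_univ_castSucc, pow_add]
    refine (h (Fin.last l)).trans (Nat.mul_le_mul_right _ ?_)
    exact ih (a := fun i => a i.castSucc) (e := fun i => e i.castSucc) h₀ fun i => h i.castSucc

theorem tightness_hierarchy (t : ℕ) (l : ℕ)
    (g : Fin (l + 1) → (∀ i, α i) → ℝ≥0) (T : Fin (l + 1) → Finset ι)
    (hg0 : HasScope (g 0) (T 0)) (hg0t : tightness (g 0) (T 0) ≤ 1)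
    (hw : Fin l → ℕ)
    (f : ∀ i : Fin l, Fin (hw i) → (∀ j, α j) → ℝ≥0)
    (Sc : ∀ i : Fin l, Fin (hw i) → Finset ι)
    (hf : ∀ i j, HasScope (f i j) (Sc i j))
    (hft : ∀ i j, tightness (f i j) (Sc i j) ≤ t)
    (Z : Fin l → Finset ι)
    (hZ : ∀ i : Fin l, Z i ⊆ T i.castSucc ∪ Finset.univ.biUnion (Sc i))
    (hT : ∀ i : Fin l, T i.succ = (T i.castSucc ∪ Finset.univ.biUnion (Sc i)) \ Z i)
    (hrec : ∀ (i : Fin l) (v : ∀ j, α j),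
      g i.succ v = ∑ z : ∀ j : Z i, α j,
        g i.castSucc (updateOn v (Z i) z) * ∏ j, f i j (updateOn v (Z i) z)) :
    tightness (g (Fin.last l)) (T (Fin.last l)) ≤ t ^ (∑ i, hw i) := by
  refine last_le_pow_sum (a := fun k => tightness (g k) (T k)) hg0t fun i => ?_
  have hstep : tightness (g i.succ) (T i.succ) ≤
      tightness (g i.castSucc) (T i.castSucc) * ∏ j, tightness (f i j) (Sc i j) := by
    refine tightness_le_mul_prod (hT i ▸ Finset.sdiff_subset) fun v hv => ?_
    rw [hrec] at hv
    obtain ⟨z, -, hz⟩ := Finset.exists_ne_zero_of_sum_ne_zero hv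
    refine ⟨updateOn v (Z i) z, fun k hk => ?_, left_ne_zero_of_mul hz,
      fun j => Finset.prod_ne_zero_iff.1 (right_ne_zero_of_mul hz) j (Finset.mem_univ j)⟩
    rw [hT] at hk
    exact dif_neg (Finset.mem_sdiff.1 hk).2
  refine hstep.trans (Nat.mul_le_mul_left _ ?_)
  simpa using Finset.prod_le_pow_card Finset.univ _ t fun j _ => hft i j
end
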